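/- The field F' = ℚ(w₁, w₂, w₃, i) is a Galois extension of ℚ of degree 48, and Gal(F'/ℚ) is isomorphic to the direct product ℤ/2ℤ × ((ℤ/2ℤ)³ ⋊ ℤ/3ℤ), where a generator of ℤ/3ℤ acts on (ℤ/2ℤ)³ by cyclic permutation of the factors. Moreover (w₁w₂w₃)² = −(1 + 3a − a³), and hence √(1 + 3a − a³) ∈ F'. -/

import Mathlib

/-- Cyclic shift of the coordinates of `(ℤ/2ℤ)³` (indices in `ℤ/3ℤ`), as a multiplicative
automorphism. -/
def cycMulAut (kk : ZMod 3) : MulAut (Multiplicative (ZMod 3 → ZMod 2)) where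
  toFun f := Multiplicative.ofAdd (fun i => Multiplicative.toAdd f (i + kk))
  invFun f := Multiplicative.ofAdd (fun i => Multiplicative.toAdd f (i - kk))
  left_inv f := by
    apply Multiplicative.toAdd.injective
    funext i
    simp
  right_inv f := by
    apply Multiplicative.toAdd.injective
    funext i
    simp
  map_mul' f g := by
    apply Multiplicative.toAdd.injective
    funext i
    simp

/-- The action of `ℤ/3ℤ` on `(ℤ/2ℤ)³` by cyclic permutation of the three factors. -/
def cycHom : Multiplicative (ZMod 3) →* MulAut (Multiplicative (ZMod 3 → ZMod 2)) :=
  MonoidHom.mk' (fun kk => cycMulAut (Multiplicative.toAdd kk)) (fun a b => by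
    refine MulEquiv.ext fun f => ?_
    apply Multiplicative.toAdd.injective
    funext i
    simp [cycMulAut, add_assoc])

open Multiplicative in
/-- The element of `ℤ/2ℤ × ((ℤ/2ℤ)³ ⋊ ℤ/3ℤ)` with the given additive coordinates. -/
def signedShift (s : ZMod 2) (f : ZMod 3 → ZMod 2) (k : ZMod 3) :
    Multiplicative (ZMod 2) ×
      (Multiplicative (ZMod 3 → ZMod 2) ⋊[cycHom] Multiplicative (ZMod 3)) :=
  (ofAdd s, ⟨ofAdd f, ofAdd k⟩)

theorem signedShift_mul (s s' : ZMod 2) (f f' : ZMod 3 → ZMod 2) (k k' : ZMod 3) :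
    signedShift s f k * signedShift s' f' k' =
      signedShift (s + s') (f + fun i => f' (i + k)) (k + k') := rfl

theorem exists_eq_signedShift (g : Multiplicative (ZMod 2) ×
      (Multiplicative (ZMod 3 → ZMod 2) ⋊[cycHom] Multiplicative (ZMod 3))) :
    ∃ s f k, g = signedShift s f k := ⟨_, _, _, rfl⟩

theorem signedShift_mul_eq {s s' s'' : ZMod 2} {f f' f'' : ZMod 3 → ZMod 2} {k k' k'' : ZMod 3}
    (hs : s + s' = s'') (hf : ∀ i, f i + f' (i + k) = f'' i) (hk : k + k' = k'') :
    signedShift s f k * signedShift s' f' k' = signedShift s'' f'' k'' := by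
  rw [signedShift_mul, hs, hk]
  congr 1
  exact funext hf

/-- A subgroup containing a suitable reflection, an element acting nontrivially on the indices and
an element of odd total sign is everything. -/
theorem signedShift_subgroup_eq_top (H : Subgroup (Multiplicative (ZMod 2) ×
      (Multiplicative (ZMod 3 → ZMod 2) ⋊[cycHom] Multiplicative (ZMod 3))))
    (hc : signedShift 1 (Pi.single 0 1) 0 ∈ H)
    (ht : ∃ s f k, k ≠ 0 ∧ signedShift s f k ∈ H)
    (hu : ∃ s f k, s + (f 0 + f 1 + f 2) = 1 ∧ signedShift s f k ∈ H) : H = ⊤ := by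
  obtain ⟨s₁, f₁, ht⟩ : ∃ s f, signedShift s f 1 ∈ H := by
    obtain ⟨s, f, k, hk, h⟩ := ht
    have : k = 1 ∨ k = 2 := by clear h; revert k; decide
    rcases this with rfl | rfl
    · exact ⟨_, _, h⟩
    · exact ⟨s + s, f + fun i => f (i + 2),
        signedShift_mul_eq rfl (fun _ => rfl) (show (2 : ZMod 3) + 2 = 1 by decide) ▸ H.mul_mem h h⟩
  have shift : ∀ {s f}, signedShift s f 0 ∈ H → signedShift s (fun i => f (i + 1)) 0 ∈ H := by
    intro s f h
    have h' : signedShift s₁ f₁ 1 * signedShift s f 0 * (signedShift s₁ f₁ 1)⁻¹ =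
        signedShift s (fun i => f (i + 1)) 0 := by
      rw [mul_inv_eq_iff_eq_mul, signedShift_mul, signedShift_mul]
      congr 1
      · ring
      · ext i; simp [add_comm]
    exact h' ▸ H.mul_mem (H.mul_mem ht h) (H.inv_mem ht)
  have hN₁ : ∀ f : ZMod 3 → ZMod 2, signedShift (f 0 + f 1 + f 2) f 0 ∈ H := by
    intro f
    have hc₁ := shift hc
    have hc₂ := shift hc₁
    have h0 : signedShift 0 0 0 ∈ H := H.one_mem
    have key : ∀ (x : ZMod 2) (g : ZMod 3 → ZMod 2), signedShift 1 g 0 ∈ H →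
        signedShift x (fun i => x * g i) 0 ∈ H := by
      intro x g hg
      have : x = 0 ∨ x = 1 := by revert x; decide
      rcases this with rfl | rfl
      · simpa [Pi.zero_def] using h0
      · simpa using hg
    have := H.mul_mem (H.mul_mem (key (f 0) _ hc) (key (f 2) _ hc₁)) (key (f 1) _ hc₂)
    rw [signedShift_mul, signedShift_mul_eq (s'' := f 0 + f 1 + f 2) (f'' := f) (k'' := 0)] at this
    · exact this
    · ring
    · clear this; revert f; decide
    · rfl
  obtain ⟨s₂, f₂, hs₂, hu⟩ : ∃ s f, s + (f 0 + f 1 + f 2) = 1 ∧ signedShift s f 0 ∈ H := by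
    obtain ⟨s, f, k, hk, h⟩ := hu
    have h3 := H.mul_mem (H.mul_mem h h) h
    rw [signedShift_mul, signedShift_mul] at h3
    have hk3 : k + k + k = 0 := by clear h h3; revert k; decide
    rw [hk3] at h3
    refine ⟨_, _, ?_, h3⟩
    revert hk
    clear h h3 hk3
    revert s f k
    decide
  have hN : ∀ s f, signedShift s f 0 ∈ H := by
    intro s f
    by_cases hs : s = f 0 + f 1 + f 2
    · exact hs ▸ hN₁ f
    · have := H.mul_mem (hN₁ (f - f₂)) hu
      rw [signedShift_mul_eq (s'' := s) (f'' := f) (k'' := 0)] at this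
      · exact this
      · simp only [Pi.sub_apply]
        generalize f 0 = x at *
        generalize f 1 = y at *
        generalize f 2 = z at *
        generalize f₂ 0 = x' at *
        generalize f₂ 1 = y' at *
        generalize f₂ 2 = z' at *
        have e₁ : s = x + y + z + 1 := by
          generalize x + y + z = v at *
          revert s v; decide
        have e₂ : s₂ = 1 - (x' + y' + z') := by linear_combination hs₂
        rw [e₁, e₂]
        have : (2 : ZMod 2) = 0 := rfl
        linear_combination (-(x' + y' + z')) * this
      · simp
      · rfl
  have hk : ∀ k : ZMod 3, ∃ s f, signedShift s f k ∈ H := by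
    intro k
    have : k = 0 ∨ k = 1 ∨ k = 2 := by revert k; decide
    rcases this with rfl | rfl | rfl
    · exact ⟨_, _, hN 0 0⟩
    · exact ⟨_, _, ht⟩
    · exact ⟨_, _, H.mul_mem ht ht⟩
  rw [eq_top_iff]
  intro g _
  obtain ⟨s, f, k, rfl⟩ := exists_eq_signedShift g
  obtain ⟨s', f', h⟩ := hk k
  have := H.mul_mem (hN (s - s') (f - f')) h
  rw [signedShift_mul_eq (s'' := s) (f'' := f) (k'' := k)] at this
  · exact this
  · ring
  · simp
  · simp

/-- The nontrivial character of `ℤ/2ℤ` with integer values. -/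
def parity (x : ZMod 2) : ℤ := if x = 0 then 1 else -1

theorem parity_add (x y : ZMod 2) : parity (x + y) = parity x * parity y := by
  revert x y; decide

theorem parity_sq (x : ZMod 2) : parity x ^ 2 = 1 := by
  revert x; decide

theorem parity_injective : Function.Injective parity := by
  decide

theorem parity_mul_cancel {L : Type*} [Field L] [CharZero L] {x y : ZMod 2} {z : L} (hz : z ≠ 0)
    (h : (parity x : L) * z = parity y * z) : x = y :=
  parity_injective (Int.cast_injective (mul_right_cancel₀ hz h))

theorem exists_parity_of_sq_eq {L : Type*} [Field L] {x y : L} (h : x ^ 2 = y ^ 2) :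
    ∃ s, x = parity s * y := by
  rcases sq_eq_sq_iff_eq_or_eq_neg.1 h with h | h
  · exact ⟨0, by simp [h, parity]⟩
  · exact ⟨1, by simp [h, parity]⟩

theorem rat_cubic_ne_zero (q : ℚ) : q ^ 3 - 3 * q + 1 ≠ 0 := by
  intro h
  have hd : (q.den : ℚ) ≠ 0 := by exact_mod_cast q.den_nz
  have h1 : (q.num : ℚ) ^ 3 - 3 * q.num * q.den ^ 2 + q.den ^ 3 = 0 := by
    have e : (q.num : ℚ) = q * q.den := (Rat.mul_den_eq_num q).symm
    rw [e]
    linear_combination (q.den : ℚ) ^ 3 * h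
  have h2 : (q.num : ℤ) ^ 3 - 3 * q.num * (q.den : ℤ) ^ 2 + (q.den : ℤ) ^ 3 = 0 := by
    exact_mod_cast h1
  have h3 : Even ((q.num : ℤ) ^ 3 - 3 * q.num * (q.den : ℤ) ^ 2 + (q.den : ℤ) ^ 3) := by
    rw [h2]; exact Even.zero
  have hn : ¬ (Even q.num ∧ Even (q.den : ℤ)) := by
    rintro ⟨h4, h5⟩
    have h6 := Nat.dvd_gcd (Int.natAbs_dvd_natAbs.2 h4.two_dvd)
      (Int.natAbs_dvd_natAbs.2 h5.two_dvd)
    rw [Int.natAbs_natCast, q.reduced] at h6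
    norm_num at h6
  have h3' : ¬ Even (3 : ℤ) := by decide
  simp only [Int.even_add, Int.even_sub, Int.even_mul, Int.even_pow, h3', ne_eq,
    OfNat.ofNat_ne_zero, not_false_eq_true, and_true, false_or] at h3
  tauto

/-- The hypotheses on the generators `w j = √(a + r j)` and `ι = √-1` of a Galois extension of `ℚ`,
where the `r j` are the roots of `X³ - 3X + 1`. -/
structure KummerData (L : Type*) [Field L] [Algebra ℚ L] where
  r : ZMod 3 → L
  w : ZMod 3 → L
  ι : L
  a : ℚ
  r_root : ∀ j, r j ^ 3 - 3 * r j + 1 = 0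
  r_succ : ∀ j, r (j + 1) * (1 - r j) = 1
  w_ne_zero : ∀ j, w j ≠ 0
  w_sq : ∀ j, w j ^ 2 = algebraMap ℚ L a + r j
  ι_sq : ι ^ 2 = -1
  hom_ext : ∀ σ τ : L ≃ₐ[ℚ] L, σ ι = τ ι → (∀ j, σ (w j) = τ (w j)) → σ = τ
  disc_not_sq : ¬∃ q : ℚ, q ^ 2 = 1 + 3 * a - a ^ 3
  conj : L ≃ₐ[ℚ] L
  conj_ι : conj ι = -ι
  conj_w : ∀ j, conj (w j) = parity (Pi.single (M := fun _ => ZMod 2) 0 1 j) * w j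

namespace KummerData

variable {L : Type*} [Field L] [Algebra ℚ L] (D : KummerData L)

theorem ι_ne_zero : D.ι ≠ 0 := by
  intro h
  have := D.ι_sq
  rw [h] at this
  norm_num at this

theorem r_succ_ne (j : ZMod 3) : D.r (j + 1) ≠ D.r j := by
  have : CharZero L := algebraRat.charZero L
  intro h
  have h1 := D.r_succ j
  rw [h] at h1
  have h2 : (3 : L) * D.r j = 0 := by
    linear_combination (-(D.r j + 1)) * h1 - D.r_root j
  have h3 : D.r j = 0 := by simpa using h2
  simp [h3] at h1

theorem r_injective : Function.Injective D.r := by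
  intro i j h
  by_contra hij
  have : i = j + 1 ∨ j = i + 1 := by clear h; revert i j; decide
  rcases this with rfl | rfl
  · exact D.r_succ_ne _ h
  · exact D.r_succ_ne _ h.symm

theorem r_eq_of_succ {x : L} {j : ZMod 3} (h : x * (1 - D.r j) = 1) : x = D.r (j + 1) := by
  have h0 : 1 - D.r j ≠ 0 := right_ne_zero_of_mul_eq_one h
  exact mul_right_cancel₀ h0 (h.trans (D.r_succ j).symm)

theorem r_relations : D.r 1 * (1 - D.r 0) = 1 ∧ D.r 2 * (1 - D.r 1) = 1 ∧
    D.r 0 * (1 - D.r 2) = 1 :=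
  ⟨D.r_succ 0, D.r_succ 1, D.r_succ 2⟩

theorem cubic_eq (x : L) :
    x ^ 3 - 3 * x + 1 = (x - D.r 0) * (x - D.r 1) * (x - D.r 2) := by
  obtain ⟨h1, h2, h3⟩ := D.r_relations
  have h0 := D.r_root 0
  have hs : D.r 0 + D.r 1 + D.r 2 = 0 := by
    have e : (1 - D.r 0) ≠ 0 := right_ne_zero_of_mul_eq_one h1
    have e' : D.r 0 ≠ 0 := left_ne_zero_of_mul_eq_one h3
    have e1 : D.r 1 = 1 / (1 - D.r 0) := by field_simp; exact h1
    have e2 : D.r 2 = 1 - 1 / D.r 0 := by field_simp; linear_combination -h3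
    rw [e1, e2]
    field_simp
    linear_combination -h0
  have hp : D.r 0 * D.r 1 + D.r 1 * D.r 2 + D.r 2 * D.r 0 = -3 := by
    linear_combination -h1 - h2 - h3 + hs
  have hpr : D.r 0 * D.r 1 * D.r 2 = -1 := by
    linear_combination h0 + D.r 0 * hp - D.r 0 ^ 2 * hs
  linear_combination x ^ 2 * hs - x * hp + hpr

theorem apply_r {σ : L ≃ₐ[ℚ] L} {m : ZMod 3} (h : σ (D.r 0) = D.r m) (j : ZMod 3) :
    σ (D.r j) = D.r (j + m) := by
  have step : ∀ j, σ (D.r j) = D.r (j + m) → σ (D.r (j + 1)) = D.r (j + 1 + m) := by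
    intro j hj
    rw [show j + 1 + m = j + m + 1 by ring]
    apply D.r_eq_of_succ
    rw [← hj]
    simpa using congrArg σ (D.r_succ j)
  have h0 : σ (D.r 0) = D.r (0 + m) := by rw [h, zero_add]
  have : j = 0 ∨ j = 0 + 1 ∨ j = 0 + 1 + 1 := by revert j; decide
  rcases this with rfl | rfl | rfl
  exacts [h0, step _ h0, step _ (step _ h0)]

theorem exists_apply_r (σ : L ≃ₐ[ℚ] L) : ∃ m, ∀ j, σ (D.r j) = D.r (j + m) := by
  have h := D.cubic_eq (σ (D.r 0))
  have h0 : σ (D.r 0) ^ 3 - 3 * σ (D.r 0) + 1 = 0 := by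
    simpa [map_ofNat σ 3] using congrArg σ (D.r_root 0)
  rw [h0, eq_comm, mul_eq_zero, mul_eq_zero, sub_eq_zero, sub_eq_zero, sub_eq_zero] at h
  rcases h with (h | h) | h
  exacts [⟨_, D.apply_r h⟩, ⟨_, D.apply_r h⟩, ⟨_, D.apply_r h⟩]

/-- `σ` permutes the `w j` and `ι` up to sign as prescribed by the coordinates of `g`. -/
def Acts (σ : L ≃ₐ[ℚ] L) (g : Multiplicative (ZMod 2) ×
      (Multiplicative (ZMod 3 → ZMod 2) ⋊[cycHom] Multiplicative (ZMod 3))) : Prop :=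
  σ D.ι = parity (Multiplicative.toAdd g.1) * D.ι ∧
    ∀ j, σ (D.w (j + Multiplicative.toAdd g.2.right)) =
      parity (Multiplicative.toAdd g.2.left j) * D.w j

theorem acts_signedShift {σ : L ≃ₐ[ℚ] L} {s f k} : D.Acts σ (signedShift s f k) ↔
    σ D.ι = parity s * D.ι ∧ ∀ j, σ (D.w (j + k)) = parity (f j) * D.w j := Iff.rfl

theorem exists_acts (σ : L ≃ₐ[ℚ] L) : ∃ g, D.Acts σ g := by
  obtain ⟨m, hm⟩ := D.exists_apply_r σ
  obtain ⟨s, hs⟩ : ∃ s, σ D.ι = parity s * D.ι := by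
    apply exists_parity_of_sq_eq
    rw [← map_pow, D.ι_sq, map_neg, map_one]
  have hf : ∀ j, ∃ t, σ (D.w (j + -m)) = parity t * D.w j := by
    intro j
    apply exists_parity_of_sq_eq
    rw [← map_pow, D.w_sq, map_add, hm, D.w_sq, AlgEquiv.commutes]
    simp
  choose f hf using hf
  exact ⟨signedShift s f (-m), D.acts_signedShift.2 ⟨hs, hf⟩⟩

theorem Acts.mul {σ τ : L ≃ₐ[ℚ] L} {g h} (hσ : D.Acts σ g) (hτ : D.Acts τ h) :
    D.Acts (σ * τ) (g * h) := by
  obtain ⟨s, f, k, rfl⟩ := exists_eq_signedShift g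
  obtain ⟨s', f', k', rfl⟩ := exists_eq_signedShift h
  rw [acts_signedShift] at hσ hτ
  rw [signedShift_mul, acts_signedShift]
  refine ⟨?_, fun j => ?_⟩
  · rw [AlgEquiv.mul_apply, hτ.1, map_mul, map_intCast, hσ.1, parity_add]
    push_cast; ring
  · rw [AlgEquiv.mul_apply, ← add_assoc, hτ.2, map_mul, map_intCast, hσ.2, Pi.add_apply,
      parity_add]
    push_cast; ring

theorem Acts.eq_of_right {σ : L ≃ₐ[ℚ] L} {g h} (hg : D.Acts σ g) (hh : D.Acts σ h) : g = h := by
  have : CharZero L := algebraRat.charZero L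
  obtain ⟨s, f, k, rfl⟩ := exists_eq_signedShift g
  obtain ⟨s', f', k', rfl⟩ := exists_eq_signedShift h
  rw [acts_signedShift] at hg hh
  have hk : k = k' := by
    have h1 : σ (D.w (0 + k)) ^ 2 = σ (D.w (0 + k')) ^ 2 := by
      rw [hg.2, hh.2, mul_pow, mul_pow]
      norm_cast
      rw [parity_sq, parity_sq]
    rw [← map_pow, ← map_pow] at h1
    have h2 := σ.injective h1
    rw [D.w_sq, D.w_sq] at h2
    simpa using D.r_injective (add_left_cancel h2)
  subst hk
  have hs : s = s' := parity_mul_cancel D.ι_ne_zero (hg.1.symm.trans hh.1)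
  have hf : f = f' := funext fun j =>
    parity_mul_cancel (D.w_ne_zero j) ((hg.2 j).symm.trans (hh.2 j))
  rw [hs, hf]

theorem Acts.eq_of_left {σ τ : L ≃ₐ[ℚ] L} {g} (hσ : D.Acts σ g) (hτ : D.Acts τ g) : σ = τ := by
  refine D.hom_ext σ τ (hσ.1.trans hτ.1.symm) fun j => ?_
  have := (hσ.2 (j - Multiplicative.toAdd g.2.right)).trans (hτ.2 _).symm
  simpa using this

/-- The coordinates of an automorphism as a group homomorphism. -/
noncomputable def toSignedShift : (L ≃ₐ[ℚ] L) →* Multiplicative (ZMod 2) ×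
      (Multiplicative (ZMod 3 → ZMod 2) ⋊[cycHom] Multiplicative (ZMod 3)) :=
  MonoidHom.mk' (fun σ => (D.exists_acts σ).choose) fun σ τ =>
    Acts.eq_of_right D (D.exists_acts (σ * τ)).choose_spec
      (Acts.mul D (D.exists_acts σ).choose_spec (D.exists_acts τ).choose_spec)

theorem acts_toSignedShift (σ : L ≃ₐ[ℚ] L) : D.Acts σ (D.toSignedShift σ) :=
  (D.exists_acts σ).choose_spec

theorem mem_range_iff {g} : g ∈ D.toSignedShift.range ↔ ∃ σ, D.Acts σ g := by
  refine ⟨?_, ?_⟩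
  · rintro ⟨σ, rfl⟩
    exact ⟨σ, D.acts_toSignedShift σ⟩
  · rintro ⟨σ, h⟩
    exact ⟨σ, Acts.eq_of_right D (D.acts_toSignedShift σ) h⟩

theorem prod_w_sq : (D.w 0 * D.w 1 * D.w 2) ^ 2 =
    -algebraMap ℚ L (1 + 3 * D.a - D.a ^ 3) := by
  have h := D.cubic_eq (-algebraMap ℚ L D.a)
  rw [mul_pow, mul_pow, D.w_sq, D.w_sq, D.w_sq]
  simp only [map_sub, map_add, map_mul, map_pow, map_one, map_ofNat]
  linear_combination h

variable [IsGalois ℚ L] [FiniteDimensional ℚ L]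

theorem exists_apply_ne {x : L} (hx : ∀ q : ℚ, algebraMap ℚ L q ≠ x) :
    ∃ σ : L ≃ₐ[ℚ] L, σ x ≠ x := by
  by_contra! h
  obtain ⟨q, hq⟩ := IntermediateField.mem_bot.1 ((IsGalois.mem_bot_iff_fixed x).2 h)
  exact hx q hq

theorem toSignedShift_range : D.toSignedShift.range = ⊤ := by
  have : CharZero L := algebraRat.charZero L
  apply signedShift_subgroup_eq_top
  · refine D.mem_range_iff.2 ⟨D.conj, D.acts_signedShift.2 ⟨?_, ?_⟩⟩
    · simp [D.conj_ι, parity]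
    · intro j
      rw [add_zero, D.conj_w]
  · obtain ⟨σ, hσ⟩ : ∃ σ : L ≃ₐ[ℚ] L, σ (D.r 0) ≠ D.r 0 := by
      refine exists_apply_ne fun q hq => rat_cubic_ne_zero q ((algebraMap ℚ L).injective ?_)
      have := D.r_root 0
      rw [← hq] at this
      simpa using this
    obtain ⟨s, f, k, h⟩ := exists_eq_signedShift (D.toSignedShift σ)
    refine ⟨s, f, k, ?_, h ▸ ⟨σ, rfl⟩⟩
    rintro rfl
    have h1 := D.acts_toSignedShift σ
    rw [h, acts_signedShift] at h1
    have h2 : σ (D.w 0) ^ 2 = D.w 0 ^ 2 := by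
      have := h1.2 0
      rw [add_zero] at this
      rw [this, mul_pow]
      norm_cast
      rw [parity_sq, Int.cast_one, one_mul]
    rw [← map_pow, D.w_sq, map_add, AlgEquiv.commutes] at h2
    exact hσ (add_left_cancel h2)
  · have hd : (D.ι * (D.w 0 * D.w 1 * D.w 2)) ^ 2 =
        algebraMap ℚ L (1 + 3 * D.a - D.a ^ 3) := by
      rw [mul_pow, D.prod_w_sq, D.ι_sq]; ring
    obtain ⟨σ, hσ⟩ : ∃ σ : L ≃ₐ[ℚ] L,
        σ (D.ι * (D.w 0 * D.w 1 * D.w 2)) ≠ D.ι * (D.w 0 * D.w 1 * D.w 2) := by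
      refine exists_apply_ne fun q hq => D.disc_not_sq ⟨q, (algebraMap ℚ L).injective ?_⟩
      rw [map_pow, hq, hd]
    obtain ⟨s, f, k, h⟩ := exists_eq_signedShift (D.toSignedShift σ)
    refine ⟨s, f, k, ?_, h ▸ ⟨σ, rfl⟩⟩
    have h1 := D.acts_toSignedShift σ
    rw [h, acts_signedShift] at h1
    have hprod : ∀ k : ZMod 3,
        D.w 0 * D.w 1 * D.w 2 = D.w (0 + k) * D.w (1 + k) * D.w (2 + k) := by
      intro k
      have : k = 0 ∨ k = 1 ∨ k = 2 := by revert k; decide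
      rcases this with rfl | rfl | rfl
      · simp
      · change _ = D.w 1 * D.w 2 * D.w 0
        ring
      · change _ = D.w 2 * D.w 0 * D.w 1
        ring
    have h2 : σ (D.ι * (D.w 0 * D.w 1 * D.w 2)) =
        parity (s + (f 0 + f 1 + f 2)) * (D.ι * (D.w 0 * D.w 1 * D.w 2)) := by
      conv_lhs => rw [hprod k]
      simp only [map_mul, h1.1, h1.2, parity_add]
      push_cast; ring
    by_contra h3
    have h4 : s + (f 0 + f 1 + f 2) = 0 := by
      generalize s + (f 0 + f 1 + f 2) = x at *
      revert h3; clear h2; revert x; decide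
    rw [h4] at h2
    exact hσ (by simpa [parity] using h2)

/-- The Galois group of the field generated by the `w j` and `ι`. -/
noncomputable def galEquiv : (L ≃ₐ[ℚ] L) ≃* Multiplicative (ZMod 2) ×
      (Multiplicative (ZMod 3 → ZMod 2) ⋊[cycHom] Multiplicative (ZMod 3)) :=
  MulEquiv.ofBijective D.toSignedShift
    ⟨fun σ τ h => Acts.eq_of_left D (D.acts_toSignedShift σ) (h ▸ D.acts_toSignedShift τ),
      MonoidHom.range_eq_top.1 D.toSignedShift_range⟩

theorem finrank_eq (D : KummerData L) : Module.finrank ℚ L = 48 := by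
  rw [← IsGalois.card_aut_eq_finrank, Nat.card_congr D.galEquiv.toEquiv, Nat.card_prod,
    Nat.card_congr (SemidirectProduct.equivProd), Nat.card_prod]
  simp

end KummerData

theorem Complex.conj_eq_self_of_sq {w : ℂ} {x : ℝ} (hx : 0 ≤ x) (h : w ^ 2 = x) :
    (starRingEnd ℂ) w = w := by
  have h1 : ((Real.sqrt x : ℝ) : ℂ) ^ 2 = x := by
    rw [← Complex.ofReal_pow, Real.sq_sqrt hx]
  rcases sq_eq_sq_iff_eq_or_eq_neg.1 (h.trans h1.symm) with h | h <;> simp [h]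

theorem Complex.conj_eq_neg_of_sq {w : ℂ} {x : ℝ} (hx : x ≤ 0) (h : w ^ 2 = x) :
    (starRingEnd ℂ) w = -w := by
  have h1 : ((Real.sqrt (-x) : ℝ) * Complex.I : ℂ) ^ 2 = x := by
    rw [mul_pow, ← Complex.ofReal_pow, Real.sq_sqrt (neg_nonneg.2 hx)]
    simp
  rcases sq_eq_sq_iff_eq_or_eq_neg.1 (h.trans h1.symm) with h | h <;> simp [h]

theorem forall_zmod_three {P : ZMod 3 → Prop} (h0 : P 0) (h1 : P 1) (h2 : P 2) (j : ZMod 3) :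
    P j := by
  have : j = 0 ∨ j = 1 ∨ j = 2 := by clear h0 h1 h2; revert j; decide
  rcases this with rfl | rfl | rfl <;> assumption

/-- The field generated by `i` and the square roots of the roots of a rational polynomial is a
splitting field. -/
theorem exists_isSplittingField_adjoin {p : Polynomial ℚ} (hp : p.Monic) {w₁ w₂ w₃ : ℂ}
    (h : ∀ x : ℂ, p.aeval x = (x - w₁ ^ 2) * (x - w₂ ^ 2) * (x - w₃ ^ 2)) :
    ∃ q : Polynomial ℚ,
      q.IsSplittingField ℚ (IntermediateField.adjoin ℚ {w₁, w₂, w₃, Complex.I}) := by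
  set q : Polynomial ℚ := (Polynomial.X ^ 2 + 1) * p.comp (Polynomial.X ^ 2) with hq
  have hI : (Polynomial.X ^ 2 + 1 : Polynomial ℚ).Monic := by
    simpa using Polynomial.monic_X_pow_add_C (1 : ℚ) (n := 2) (by norm_num)
  have hq0 : q ≠ 0 := (hI.mul (hp.comp (Polynomial.monic_X_pow 2) (by simp))).ne_zero
  have hroot : ∀ x : ℂ, q.aeval x =
      (x ^ 2 - Complex.I ^ 2) * ((x ^ 2 - w₁ ^ 2) * (x ^ 2 - w₂ ^ 2) * (x ^ 2 - w₃ ^ 2)) := by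
    intro x
    simp [hq, Polynomial.aeval_comp, h]
  have hmem : ∀ x : ℂ, x ∈ q.rootSet ℂ ↔
      (x ^ 2 - Complex.I ^ 2) * ((x ^ 2 - w₁ ^ 2) * (x ^ 2 - w₂ ^ 2) * (x ^ 2 - w₃ ^ 2)) = 0 := by
    intro x
    rw [Polynomial.mem_rootSet_of_ne hq0, hroot]
  refine ⟨q, ?_⟩
  have heq : IntermediateField.adjoin ℚ {w₁, w₂, w₃, Complex.I} =
      IntermediateField.adjoin ℚ (q.rootSet ℂ) := by
    apply le_antisymm
    · apply IntermediateField.adjoin.mono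
      rintro x (rfl | rfl | rfl | rfl) <;> rw [hmem] <;> ring
    · rw [IntermediateField.adjoin_le_iff]
      intro x hx
      have gen : ∀ y ∈ ({w₁, w₂, w₃, Complex.I} : Set ℂ), x ^ 2 - y ^ 2 = 0 →
          x ∈ IntermediateField.adjoin ℚ {w₁, w₂, w₃, Complex.I} := by
        intro y hy hxy
        have hy' := IntermediateField.subset_adjoin ℚ _ hy
        rcases sq_eq_sq_iff_eq_or_eq_neg.1 (sub_eq_zero.1 hxy) with rfl | rfl
        exacts [hy', neg_mem hy']
      rw [hmem, mul_eq_zero, mul_eq_zero, mul_eq_zero] at hx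
      rcases hx with hx | (hx | hx) | hx
      exacts [gen _ (by simp) hx, gen _ (by simp) hx, gen _ (by simp) hx, gen _ (by simp) hx]
  rw [heq]
  exact IntermediateField.adjoin_rootSet_isSplittingField (IsAlgClosed.splits _)

/-- `F' = ℚ(w₁, w₂, w₃, i)` is Galois over `ℚ` of degree `48`, with
`Gal(F'/ℚ) ≅ ℤ/2ℤ × ((ℤ/2ℤ)³ ⋊ ℤ/3ℤ)`; moreover `(w₁w₂w₃)² = −(1 + 3a − a³)`, whence
`√(1 + 3a − a³) ∈ F'`. -/
theorem stmt16 (ρ ρ₂ ρ₃ : ℝ) (hρroot : ρ ^ 3 - 3 * ρ + 1 = 0) (hρneg : ρ < 0)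
    (hρ₂ : ρ₂ = 1 / (1 - ρ)) (hρ₃ : ρ₃ = 1 - 1 / ρ)
    (a : ℚ) (ha₀ : 0 < a) (ha₁ : (a : ℝ) < -ρ)
    (hans : ¬∃ q : ℚ, q ^ 2 = 1 + 3 * a - a ^ 3)
    (w₁ w₂ w₃ : ℂ) (hw₁ : w₁ ^ 2 = ((a : ℝ) + ρ : ℝ)) (hw₂ : w₂ ^ 2 = ((a : ℝ) + ρ₂ : ℝ))
    (hw₃ : w₃ ^ 2 = ((a : ℝ) + ρ₃ : ℝ))
    (F' : IntermediateField ℚ ℂ)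
    (hF' : F' = IntermediateField.adjoin ℚ {w₁, w₂, w₃, Complex.I}) :
    IsGalois ℚ F' ∧
    Module.finrank ℚ F' = 48 ∧
    Nonempty ((F' ≃ₐ[ℚ] F') ≃*
      (Multiplicative (ZMod 2) ×
        (Multiplicative (ZMod 3 → ZMod 2) ⋊[cycHom] Multiplicative (ZMod 3)))) ∧
    (w₁ * w₂ * w₃) ^ 2 = -((1 + 3 * (a : ℝ) - (a : ℝ) ^ 3 : ℝ) : ℂ) ∧
    ((Real.sqrt (1 + 3 * (a : ℝ) - (a : ℝ) ^ 3) : ℝ) : ℂ) ∈ F' := by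
  have hρ0 : ρ ≠ 0 := hρneg.ne
  have hρ1 : 0 < 1 - ρ := by linarith
  have hρ₂pos : 0 < ρ₂ := by rw [hρ₂]; positivity
  have hρ₃pos : 0 < ρ₃ := by
    have : 1 / ρ < 0 := one_div_neg.2 hρneg
    rw [hρ₃]; linarith
  have haR : (0 : ℝ) < a := by exact_mod_cast ha₀
  have h12 : ρ₂ * (1 - ρ) = 1 := by rw [hρ₂]; field_simp
  have h31 : ρ * (1 - ρ₃) = 1 := by rw [hρ₃]; field_simp; ring
  have h3eq : ρ₃ = ρ ^ 2 - 2 := mul_left_cancel₀ hρ0 (by linear_combination -h31 - hρroot)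
  have h2eq : ρ₂ = 2 - ρ - ρ ^ 2 :=
    mul_right_cancel₀ hρ1.ne' (by linear_combination h12 - hρroot)
  have h23 : ρ₃ * (1 - ρ₂) = 1 := by
    rw [h3eq, h2eq]; linear_combination (ρ + 1) * hρroot
  have hroot₂ : ρ₂ ^ 3 - 3 * ρ₂ + 1 = 0 := by
    rw [h2eq]
    linear_combination (-ρ ^ 3 - 3 * ρ ^ 2 + 3) * hρroot
  have hroot₃ : ρ₃ ^ 3 - 3 * ρ₃ + 1 = 0 := by
    rw [h3eq]
    linear_combination (ρ ^ 3 - 3 * ρ - 1) * hρroot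
  have hcubic : ∀ x : ℂ, (x - (a : ℂ)) ^ 3 - 3 * (x - (a : ℂ)) + 1 =
      (x - w₁ ^ 2) * (x - w₂ ^ 2) * (x - w₃ ^ 2) := by
    intro x
    rw [hw₁, hw₂, hw₃, h2eq, h3eq]
    have hc : (ρ : ℂ) ^ 3 - 3 * ρ + 1 = 0 := by exact_mod_cast hρroot
    push_cast
    linear_combination ((x - a) * (ρ + 1) - ρ ^ 2 - ρ + 1) * hc
  have hsq : (w₁ * w₂ * w₃) ^ 2 = -((1 + 3 * (a : ℝ) - (a : ℝ) ^ 3 : ℝ) : ℂ) := by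
    have := hcubic 0
    push_cast
    linear_combination this
  obtain ⟨q, hsplit⟩ : ∃ q : Polynomial ℚ, q.IsSplittingField ℚ F' := by
    have hp : ((Polynomial.X : Polynomial ℚ) ^ 3 - 3 * Polynomial.X + 1).Monic := by
      monicity!
    rw [hF']
    refine exists_isSplittingField_adjoin
      (hp.comp (Polynomial.monic_X_sub_C a) (by simp)) fun x => ?_
    rw [← hcubic]
    simp [map_ofNat]
  have hgal : IsGalois ℚ F' := by
    have : Normal ℚ F' := Normal.of_isSplittingField q
    exact ⟨⟩
  have hfin : FiniteDimensional ℚ F' := Polynomial.IsSplittingField.finiteDimensional F' q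
  have hgen : ∀ x ∈ ({w₁, w₂, w₃, Complex.I} : Set ℂ), x ∈ F' := by
    rw [hF']
    exact fun x hx => IntermediateField.subset_adjoin ℚ _ hx
  have m₁ : w₁ ∈ F' := hgen _ (by simp)
  have m₂ : w₂ ∈ F' := hgen _ (by simp)
  have m₃ : w₃ ∈ F' := hgen _ (by simp)
  have mI : Complex.I ∈ F' := hgen _ (by simp)
  let w : ZMod 3 → F' := ![⟨w₁, m₁⟩, ⟨w₂, m₂⟩, ⟨w₃, m₃⟩]
  let r : ZMod 3 → F' := fun j => w j ^ 2 - algebraMap ℚ F' a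
  have hr₁ : (r 0 : ℂ) = ρ := by
    change w₁ ^ 2 - (a : ℂ) = ρ
    rw [hw₁]; push_cast; ring
  have hr₂ : (r 1 : ℂ) = ρ₂ := by
    change w₂ ^ 2 - (a : ℂ) = ρ₂
    rw [hw₂]; push_cast; ring
  have hr₃ : (r 2 : ℂ) = ρ₃ := by
    change w₃ ^ 2 - (a : ℂ) = ρ₃
    rw [hw₃]; push_cast; ring
  let c : F' ≃ₐ[ℚ] F' := (Complex.conjAe.restrictScalars ℚ).restrictNormal F'
  have hc : ∀ x : F', ((c x : F') : ℂ) = (starRingEnd ℂ) (x : ℂ) := fun x =>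
    AlgEquiv.restrictNormal_commutes (Complex.conjAe.restrictScalars ℚ) F' x
  have ne_zero : ∀ {z : ℂ} {x : ℝ}, x ≠ 0 → z ^ 2 = x → z ≠ 0 := by
    rintro z x hx h rfl
    apply hx
    exact_mod_cast (by simpa using h.symm : (x : ℂ) = 0)
  let D : KummerData F' :=
    { r := r
      w := w
      ι := ⟨Complex.I, mI⟩
      a := a
      r_root := by
        apply forall_zmod_three <;> apply Subtype.val_injective
        · have : (ρ : ℂ) ^ 3 - 3 * ρ + 1 = 0 := by exact_mod_cast hρroot
          rw [← hr₁] at this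
          exact this
        · have : (ρ₂ : ℂ) ^ 3 - 3 * ρ₂ + 1 = 0 := by exact_mod_cast hroot₂
          rw [← hr₂] at this
          exact this
        · have : (ρ₃ : ℂ) ^ 3 - 3 * ρ₃ + 1 = 0 := by exact_mod_cast hroot₃
          rw [← hr₃] at this
          exact this
      r_succ := by
        apply forall_zmod_three <;> apply Subtype.val_injective
        · have : (ρ₂ : ℂ) * (1 - ρ) = 1 := by exact_mod_cast h12
          rw [← hr₁, ← hr₂] at this
          exact this
        · have : (ρ₃ : ℂ) * (1 - ρ₂) = 1 := by exact_mod_cast h23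
          rw [← hr₂, ← hr₃] at this
          exact this
        · have : (ρ : ℂ) * (1 - ρ₃) = 1 := by exact_mod_cast h31
          rw [← hr₁, ← hr₃] at this
          exact this
      w_ne_zero := by
        apply forall_zmod_three <;> intro h
        · exact ne_zero (by linarith) hw₁ (congrArg Subtype.val h)
        · exact ne_zero (by linarith) hw₂ (congrArg Subtype.val h)
        · exact ne_zero (by linarith) hw₃ (congrArg Subtype.val h)
      w_sq := fun j => by simp only [r]; ring
      ι_sq := Subtype.val_injective Complex.I_sq
      hom_ext := by
        intro σ τ hι hw
        have key : (σ : F' →ₐ[ℚ] F') = τ := by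
          refine IntermediateField.algHom_ext_of_eq_adjoin _ hF' ?_
          rintro x (rfl | rfl | rfl | rfl)
          exacts [hw 0, hw 1, hw 2, hι]
        exact AlgEquiv.ext fun x => DFunLike.congr_fun key x
      disc_not_sq := hans
      conj := c
      conj_ι := Subtype.val_injective ((hc _).trans Complex.conj_I)
      conj_w := by
        apply forall_zmod_three <;> apply Subtype.val_injective
        · refine (hc _).trans ((Complex.conj_eq_neg_of_sq (by linarith) hw₁).trans ?_)
          simp [parity, w]
        · refine (hc _).trans ((Complex.conj_eq_self_of_sq (by linarith) hw₂).trans ?_)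
          simp [parity, w]
        · refine (hc _).trans ((Complex.conj_eq_self_of_sq (by linarith) hw₃).trans ?_)
          have : (Pi.single 0 1 : ZMod 3 → ZMod 2) 2 = 0 := by decide
          simp only [parity, this]
          simp
          rfl }
  refine ⟨hgal, D.finrank_eq, ⟨D.galEquiv⟩, hsq, ?_⟩
  have hpos : 0 ≤ 1 + 3 * (a : ℝ) - (a : ℝ) ^ 3 := by
    have e : 1 + 3 * (a : ℝ) - (a : ℝ) ^ 3 = -(a + ρ) * (a + ρ₂) * (a + ρ₃) := by
      rw [h2eq, h3eq]
      linear_combination (-(a : ℝ) * (ρ + 1) - ρ ^ 2 - ρ + 1) * hρroot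
    rw [e]
    have : 0 ≤ -(a + ρ) := by linarith
    positivity
  have hs : ((Real.sqrt (1 + 3 * (a : ℝ) - (a : ℝ) ^ 3) : ℝ) : ℂ) ^ 2 =
      (Complex.I * (w₁ * w₂ * w₃)) ^ 2 := by
    rw [← Complex.ofReal_pow, Real.sq_sqrt hpos, mul_pow, hsq, Complex.I_sq]
    ring
  have hm : Complex.I * (w₁ * w₂ * w₃) ∈ F' := mul_mem mI (mul_mem (mul_mem m₁ m₂) m₃)
  rcases sq_eq_sq_iff_eq_or_eq_neg.1 hs with h | h
  · rw [h]; exact hm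
  · rw [h]; exact neg_mem hm
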